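/- Let (X, Σ, m) be an atomless probability space such that card Σ ≤ card X and such that card Y = card X for every Y ∈ Σ with m(Y) > 0. Then there is a well-ordering of X that captures (X, Σ, m): a bijection x from the ordinals below the initial ordinal of cardinality card X onto X such that M̄(Ax) = m(A) for every A ∈ Σ. -/

import Mathlib

open Ordinal

/-- The number `n` of full blocks in the standard decomposition `o = ω^σ·n + ρ`,
where `ω^σ = ω ^ log ω o` is the largest indecomposable ordinal `≤ o`. -/
noncomputable def stdBlocks (o : Ordinal.{0}) : ℕ :=
  Cardinal.toNat (o / omega0 ^ log omega0 o).card

/-- The upper mean `M̄` of a transfinite sequence of reals.  A sequence of length `o`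
is encoded as a total function `f : Ordinal → ℝ`; only the values of `f` at ordinals
`< o` are ever used.  It is defined by transfinite recursion on `o`:
(1) for `o = 1` it is `f 0`;
(2) for `o` indecomposable with `o > 1` (i.e. `o = ω^σ` with `σ > 0`) it is
    `limsup_{ξ → o} M̄(f|_ξ) = inf_{1 ≤ ζ < o} sup_{ζ ≤ ξ < o} M̄(f|_ξ)`;
(3) for decomposable `o`, writing `o = ω^σ·n + ρ` with `ρ < ω^σ`, it is the average
    `(1/n) (M̄(s₀) + ⋯ + M̄(s_{n-1}))` of the upper means of the `n` consecutive
    blocks of `f` of length `ω^σ` (the remainder of length `ρ` is discarded). -/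
noncomputable def upperMean (o : Ordinal.{0}) (f : Ordinal.{0} → ℝ) : ℝ :=
  if o = 1 then f 0
  else if h1 : 1 < o ∧ o = omega0 ^ log omega0 o then
    ⨅ ζ : Set.Ico (1 : Ordinal.{0}) o, ⨆ ξ : Set.Ico ζ.1 o, upperMean ξ.1 f
  else if h2 : 1 < o then
    ((stdBlocks o : ℝ))⁻¹ *
      ∑ i ∈ Finset.range (stdBlocks o),
        upperMean (omega0 ^ log omega0 o)
          (fun ξ => f (omega0 ^ log omega0 o * (i : Ordinal) + ξ))
  else 0
termination_by o
decreasing_by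
  · exact ξ.2.2
  · exact lt_of_le_of_ne (opow_log_le_self _ (zero_lt_one.trans h2).ne')
      fun h => h1 ⟨h2, h.symm⟩

/-- A transfinite sequence of reals of length `o` is bounded if its range
(on indices `< o`) is bounded in `ℝ`. -/
def SeqBounded (o : Ordinal.{0}) (f : Ordinal.{0} → ℝ) : Prop :=
  ∃ C : ℝ, ∀ ξ < o, |f ξ| ≤ C

/-- The concatenation `r ⊕ s` of a sequence `r` of length `a` with a sequence `s`:
its first `a` entries are those of `r`, and its entry at `a + ξ'` is `s ξ'`. -/
noncomputable def concatSeq (a : Ordinal.{0}) (r s : Ordinal.{0} → ℝ) :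
    Ordinal.{0} → ℝ :=
  fun ξ => if ξ < a then r ξ else s (ξ - a)

/-- An ordinal is indecomposable if it is nonzero and not the sum of two strictly
smaller ordinals. -/
def IsIndecomposable (o : Ordinal.{0}) : Prop :=
  o ≠ 0 ∧ ∀ b < o, ∀ c < o, b + c ≠ o

/-- The concatenation `s₀ ⊕ s₁ ⊕ ⋯ ⊕ s_{n-1}` of `n` sequences, each of length `β`;
the result has length `β * n`. -/
noncomputable def concatN (β : Ordinal.{0}) :
    (n : ℕ) → (Fin n → Ordinal.{0} → ℝ) → Ordinal.{0} → ℝ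
  | 0, _ => fun _ => 0
  | n + 1, s => concatSeq (β * n) (concatN β n (fun i => s i.castSucc)) (s (Fin.last n))

/-- `s / β`: given a sequence `s` whose length is `β * α`, the sequence of length `α`
whose `ι`-th entry is the upper mean of the `ι`-th consecutive block of `s` of
length `β`. -/
noncomputable def seqDiv (s : Ordinal.{0} → ℝ) (β : Ordinal.{0}) : Ordinal.{0} → ℝ :=
  fun ι => upperMean β (fun ξ => s (β * ι + ξ))

/-- The lower mean `𝕄̲(s) = -M̄(-s)`. -/
noncomputable def lowerMean (o : Ordinal.{0}) (s : Ordinal.{0} → ℝ) : ℝ :=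
  - upperMean o (fun ξ => - s ξ)

/-- A sequence `s` of length `o` has mean `c` when its upper and lower means both
equal `c`. -/
def HasMean (o : Ordinal.{0}) (s : Ordinal.{0} → ℝ) (c : ℝ) : Prop :=
  upperMean o s = c ∧ lowerMean o s = c

open MeasureTheory

theorem upperMean_opow {σ : Ordinal.{0}} (hσ : σ ≠ 0) (f : Ordinal.{0} → ℝ) :
    upperMean (ω ^ σ) f =
      ⨅ ζ : Set.Ico (1 : Ordinal.{0}) (ω ^ σ), ⨆ ξ : Set.Ico ζ.1 (ω ^ σ), upperMean ξ.1 f := by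
  have h1 : (1 : Ordinal.{0}) < ω ^ σ := one_lt_opow.2 ⟨one_lt_omega0, hσ⟩
  conv_lhs => unfold upperMean
  rw [if_neg h1.ne', dif_pos ⟨h1, by rw [log_opow one_lt_omega0]⟩]

theorem stdBlocks_opow_mul_add {σ ρ : Ordinal.{0}} {n : ℕ} (hn : n ≠ 0) (hρ : ρ < ω ^ σ) :
    log ω (ω ^ σ * n + ρ) = σ ∧ stdBlocks (ω ^ σ * n + ρ) = n := by
  have hn' : (n : Ordinal.{0}) ≠ 0 := Nat.cast_ne_zero.2 hn
  have hlog : log ω (ω ^ σ * n + ρ) = σ := by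
    rw [log_opow_mul_add one_lt_omega0 hn' hρ,
      log_eq_zero (natCast_lt_omega0 n), add_zero]
  refine ⟨hlog, ?_⟩
  have h0 : (ω : Ordinal.{0}) ^ σ ≠ 0 := (opow_pos σ omega0_pos).ne'
  rw [stdBlocks, hlog, mul_add_div _ h0, div_eq_zero_of_lt hρ, add_zero, card_nat,
    Cardinal.toNat_natCast]

theorem upperMean_opow_mul_add {σ ρ : Ordinal.{0}} {n : ℕ} (hn : n ≠ 0) (hρ : ρ < ω ^ σ)
    (f : Ordinal.{0} → ℝ) :
    upperMean (ω ^ σ * n + ρ) f =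
      (n : ℝ)⁻¹ * ∑ i ∈ Finset.range n, upperMean (ω ^ σ) (fun ξ => f (ω ^ σ * i + ξ)) := by
  obtain ⟨hlog, hblocks⟩ := stdBlocks_opow_mul_add hn hρ
  have hpos : (0 : Ordinal.{0}) < ω ^ σ := opow_pos σ omega0_pos
  have hle : ω ^ σ ≤ ω ^ σ * n + ρ :=
    (le_mul_left _ (by exact_mod_cast Nat.pos_of_ne_zero hn)).trans le_self_add
  by_cases heq : ω ^ σ * n + ρ = ω ^ σ
  · have : n = 1 := by
      have h2 := (stdBlocks_opow_mul_add (σ := σ) (n := 1) one_ne_zero hpos).2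
      rw [← hblocks, heq]
      simpa using h2
    subst this
    rw [heq]
    simp
  · have h1 : 1 < ω ^ σ * n + ρ :=
      (Order.one_le_iff_pos.2 hpos).trans_lt (lt_of_le_of_ne hle (Ne.symm heq))
    conv_lhs => unfold upperMean
    rw [if_neg h1.ne', dif_neg (by rw [hlog]; exact fun h => heq h.2), dif_pos h1, hlog, hblocks]

theorem abs_upperMean_le {C : ℝ} (o : Ordinal.{0}) :
    ∀ f : Ordinal.{0} → ℝ, (∀ ξ, |f ξ| ≤ C) → |upperMean o f| ≤ C := by
  induction o using WellFoundedLT.induction with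
  | _ o ih =>
  intro f hf
  have hC : 0 ≤ C := (abs_nonneg _).trans (hf 0)
  unfold upperMean
  split_ifs with h0 h1 h2
  · exact hf 0
  · have hbdd (ξ : Ordinal.{0}) (h : ξ < o) := abs_le.1 (ih ξ h f hf)
    have hsup (ζ : Set.Ico (1 : Ordinal.{0}) o) :
        -C ≤ ⨆ ξ : Set.Ico ζ.1 o, upperMean ξ.1 f :=
      (hbdd ζ.1 ζ.2.2).1.trans (le_ciSup (f := fun ξ : Set.Ico ζ.1 o => upperMean ξ.1 f)
        ⟨C, by rintro _ ⟨ξ, rfl⟩; exact (hbdd ξ.1 ξ.2.2).2⟩ ⟨ζ.1, le_rfl, ζ.2.2⟩)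
    have : Nonempty (Set.Ico (1 : Ordinal.{0}) o) := ⟨⟨1, le_rfl, h1.1⟩⟩
    refine abs_le.2 ⟨le_ciInf hsup, ?_⟩
    refine ciInf_le_of_le ⟨-C, by rintro _ ⟨ζ, rfl⟩; exact hsup ζ⟩ ⟨1, le_rfl, h1.1⟩ ?_
    exact ciSup_le fun ξ => (hbdd ξ.1 ξ.2.2).2
  · have hlt : ω ^ log ω o < o := lt_of_le_of_ne (opow_log_le_self _ (zero_lt_one.trans h2).ne')
      fun h => h1 ⟨h2, h.symm⟩
    rw [abs_mul, abs_of_nonneg (by positivity : (0 : ℝ) ≤ (stdBlocks o : ℝ)⁻¹)]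
    have hsum := (Finset.abs_sum_le_sum_abs (fun i : ℕ => upperMean (ω ^ log ω o)
      (fun ξ => f (ω ^ log ω o * i + ξ))) (Finset.range (stdBlocks o))).trans
        (Finset.sum_le_sum fun i _ => ih _ hlt (fun ξ => f (ω ^ log ω o * i + ξ)) fun ξ => hf _)
    rw [Finset.sum_const, Finset.card_range, _root_.nsmul_eq_mul] at hsum
    rcases (Nat.cast_nonneg (α := ℝ) (stdBlocks o)).eq_or_lt with h | h
    · rw [← h]; simpa using hC
    · rwa [inv_mul_le_iff₀ h]
  · simpa using hC

/-- The upper mean at an indecomposable length is the limit of the upper means of the initial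
segments, when that limit exists. -/
theorem upperMean_opow_eq_of_eventually {σ : Ordinal.{0}} (hσ : σ ≠ 0) {f : Ordinal.{0} → ℝ}
    {C c : ℝ} (hf : ∀ ξ, |f ξ| ≤ C)
    (h : ∀ ε > 0, ∃ ζ < ω ^ σ, ∀ ξ, ζ ≤ ξ → ξ < ω ^ σ → |upperMean ξ f - c| ≤ ε) :
    upperMean (ω ^ σ) f = c := by
  have h1 : (1 : Ordinal.{0}) < ω ^ σ := one_lt_opow.2 ⟨one_lt_omega0, hσ⟩
  have hbdd (ξ : Ordinal.{0}) := abs_le.1 (abs_upperMean_le ξ f hf)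
  rw [upperMean_opow hσ]
  have hle (ζ : Set.Ico (1 : Ordinal.{0}) (ω ^ σ)) (ξ : Ordinal.{0}) (h₁ : ζ.1 ≤ ξ)
      (h₂ : ξ < ω ^ σ) : upperMean ξ f ≤ ⨆ ξ : Set.Ico ζ.1 (ω ^ σ), upperMean ξ.1 f :=
    le_ciSup (f := fun ξ : Set.Ico ζ.1 (ω ^ σ) => upperMean ξ.1 f)
      ⟨C, by rintro _ ⟨ξ, rfl⟩; exact (hbdd ξ.1).2⟩ ⟨ξ, h₁, h₂⟩
  have : Nonempty (Set.Ico (1 : Ordinal.{0}) (ω ^ σ)) := ⟨⟨1, le_rfl, h1⟩⟩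
  apply le_antisymm
  · refine le_of_forall_pos_le_add fun ε hε => ?_
    obtain ⟨ζ, hζ, H⟩ := h ε hε
    have hmax : max 1 ζ < ω ^ σ := max_lt h1 hζ
    refine ciInf_le_of_le ⟨-C, ?_⟩ ⟨max 1 ζ, le_max_left _ _, hmax⟩ ?_
    · rintro _ ⟨ζ, rfl⟩
      exact (hbdd ζ.1).1.trans (hle ζ ζ.1 le_rfl ζ.2.2)
    · have : Nonempty (Set.Ico (max 1 ζ) (ω ^ σ)) := ⟨⟨max 1 ζ, le_rfl, hmax⟩⟩
      refine ciSup_le fun ξ => ?_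
      have := (abs_le.1 (H ξ.1 ((le_max_right _ _).trans ξ.2.1) ξ.2.2)).2
      linarith
  · refine le_ciInf fun ζ => le_of_forall_pos_le_add fun ε hε => ?_
    obtain ⟨ζ', hζ', H⟩ := h ε hε
    have hmax : max ζ.1 ζ' < ω ^ σ := max_lt ζ.2.2 hζ'
    have h₁ := (abs_le.1 (H _ (le_max_right ζ.1 ζ') hmax)).1
    have h₂ := hle ζ _ (le_max_left _ _) hmax
    linarith

/-- Every nonzero ordinal has a standard decomposition. -/
theorem exists_eq_opow_mul_add {ξ : Ordinal.{0}} (hξ : ξ ≠ 0) :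
    ∃ n : ℕ, n ≠ 0 ∧ ∃ ρ < ω ^ log ω ξ, ξ = ω ^ log ω ξ * n + ρ := by
  obtain ⟨n, hn⟩ := lt_omega0.1 (div_opow_log_lt ξ one_lt_omega0)
  have hpos := div_opow_log_pos ω hξ
  refine ⟨n, ?_, ξ % ω ^ log ω ξ, mod_lt _ (opow_pos _ omega0_pos).ne', ?_⟩
  · rintro rfl
    simp [hn] at hpos
  · rw [← hn, div_add_mod]

theorem upperMean_opow_add_one_of_tendsto {τ : Ordinal.{0}} {f : Ordinal.{0} → ℝ} {C c : ℝ}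
    (hf : ∀ ξ, |f ξ| ≤ C)
    (h : Filter.Tendsto (fun n : ℕ => (n : ℝ)⁻¹ *
      ∑ i ∈ Finset.range n, upperMean (ω ^ τ) (fun ξ => f (ω ^ τ * i + ξ)))
      Filter.atTop (nhds c)) :
    upperMean (ω ^ (τ + 1)) f = c := by
  refine upperMean_opow_eq_of_eventually (by simp) hf fun ε hε => ?_
  obtain ⟨N, hN⟩ := Metric.tendsto_atTop.1 h ε hε
  have hpos : (0 : Ordinal.{0}) < ω ^ τ := opow_pos τ omega0_pos
  refine ⟨ω ^ τ * (N + 1 : ℕ), ?_, fun ξ h₁ h₂ => ?_⟩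
  · rw [opow_add, opow_one]
    exact mul_lt_mul_of_pos_left (natCast_lt_omega0 _) hpos
  · rw [opow_add, opow_one, lt_mul_iff_div_lt hpos.ne'] at h₂
    obtain ⟨n, hn⟩ := lt_omega0.1 h₂
    have hNn : N + 1 ≤ n := by
      rw [mul_le_iff_le_div hpos.ne', hn] at h₁
      exact_mod_cast h₁
    rw [← div_add_mod ξ (ω ^ τ), hn, upperMean_opow_mul_add (by omega) (mod_lt _ hpos.ne')]
    exact (hN n (by omega)).le

theorem upperMean_omega0_of_tendsto {f : Ordinal.{0} → ℝ} {C c : ℝ} (hf : ∀ ξ, |f ξ| ≤ C)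
    (h : Filter.Tendsto (fun n : ℕ => (∑ i ∈ Finset.range n, f i) / n) Filter.atTop (nhds c)) :
    upperMean ω f = c := by
  have := upperMean_opow_add_one_of_tendsto (τ := 0) (c := c) hf (by
    have h1 (g : Ordinal.{0} → ℝ) : upperMean 1 g = g 0 := by
      unfold upperMean
      simp
    simpa [h1, div_eq_inv_mul] using h)
  simpa using this

theorem upperMean_opow_add_one_of_blocks {τ : Ordinal.{0}} {f : Ordinal.{0} → ℝ} {C c : ℝ}
    (hf : ∀ ξ, |f ξ| ≤ C)
    (h : ∀ n : ℕ, n ≠ 0 → upperMean (ω ^ τ) (fun ξ => f (ω ^ τ * n + ξ)) = c) :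
    upperMean (ω ^ (τ + 1)) f = c := by
  refine upperMean_opow_add_one_of_tendsto hf ?_
  rw [← Filter.tendsto_add_atTop_iff_nat 1]
  have hlim : Filter.Tendsto (fun n : ℕ => c + (upperMean (ω ^ τ) f - c) * (1 / ((n : ℝ) + 1)))
      Filter.atTop (nhds (c + (upperMean (ω ^ τ) f - c) * 0)) :=
    (tendsto_one_div_add_atTop_nhds_zero_nat.const_mul _).const_add _
  rw [mul_zero, add_zero] at hlim
  refine hlim.congr fun n => ?_
  rw [Finset.sum_range_succ', Finset.sum_congr rfl fun i _ => h (i + 1) (by omega)]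
  simp
  field_simp
  ring

/-- If all blocks of length `ω ^ μ` except possibly the first have upper mean `c`, for each `μ`
strictly between `η` and `σ`, then the initial segments of length `ω ^ τ` have upper mean `c`. -/
theorem upperMean_opow_of_blocks {η σ : Ordinal.{0}} {f : Ordinal.{0} → ℝ} {C c : ℝ}
    (hf : ∀ ξ, |f ξ| ≤ C)
    (h : ∀ μ, η < μ → μ < σ → ∀ n : ℕ, n ≠ 0 →
      upperMean (ω ^ μ) (fun ξ => f (ω ^ μ * n + ξ)) = c) (τ : Ordinal.{0}) :
    τ ≤ σ → η + 1 < τ → upperMean (ω ^ τ) f = c := by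
  induction τ using Ordinal.limitRecOn with
  | zero => intro _ h0; exact absurd h0 not_lt_zero
  | add_one τ _ =>
    intro hτ hη
    exact upperMean_opow_add_one_of_blocks hf fun n hn =>
      h τ (by simpa using hη) ((Order.lt_add_one_iff.2 le_rfl).trans_le hτ) n hn
  | limit τ hlim ih =>
    intro hτ hη
    refine upperMean_opow_eq_of_eventually (zero_le.trans_lt hη).ne' hf fun ε hε =>
      ⟨ω ^ (η + 1 + 1), (opow_lt_opow_iff_right one_lt_omega0).2 (hlim.add_one_lt hη),
        fun ξ h₁ h₂ => ?_⟩
    have hξ : ξ ≠ 0 := ((opow_pos _ omega0_pos).trans_le h₁).ne'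
    have hμ₁ : η + 1 < log ω ξ := by
      rw [← Order.add_one_le_iff]
      exact le_log_of_opow_le one_lt_omega0 h₁
    have hμ₂ : log ω ξ < τ := (lt_opow_iff_log_lt one_lt_omega0 hξ).1 h₂
    obtain ⟨n, hn, ρ, hρ, heq⟩ := exists_eq_opow_mul_add hξ
    generalize log ω ξ = μ at *
    have hblock : ∀ i ∈ Finset.range n, upperMean (ω ^ μ) (fun ξ => f (ω ^ μ * i + ξ)) = c := by
      intro i _
      rcases eq_or_ne i 0 with rfl | hi
      · simpa using ih μ hμ₂ (hμ₂.le.trans hτ) hμ₁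
      · exact h μ ((Order.lt_add_one_iff.2 le_rfl).trans hμ₁) (hμ₂.trans_le hτ) i hi
    rw [heq, upperMean_opow_mul_add hn hρ, Finset.sum_congr rfl hblock]
    have hn' : (n : ℝ) ≠ 0 := Nat.cast_ne_zero.2 hn
    simp [hn', hε.le]

/-- A set `S` of positions forces means at `ω ^ σ` if a sequence with values in `[-1, 1]` has upper
mean `c` at length `ω ^ σ` whenever its `ω`-blocks starting at positions in `S` have
upper mean `c`. -/
def ForcesMean (σ : Ordinal.{0}) (S : Set Ordinal.{0}) : Prop :=
  ∀ (f : Ordinal.{0} → ℝ) (c : ℝ), (∀ ξ, |f ξ| ≤ 1) →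
    (∀ ξ < ω ^ σ, ω ∣ ξ → ξ ∈ S → upperMean ω (fun n => f (ξ + n)) = c) →
    upperMean (ω ^ σ) f = c

theorem ForcesMean.upperMean_block {τ σ : Ordinal.{0}} {S T : Set Ordinal.{0}}
    {f : Ordinal.{0} → ℝ} {c : ℝ} (hS : ForcesMean τ S) (hτ : τ ≠ 0) (hτσ : τ < σ)
    (hf : ∀ ξ, |f ξ| ≤ 1)
    (hT : ∀ ξ < ω ^ σ, ω ∣ ξ → ξ ∈ T → upperMean ω (fun n => f (ξ + n)) = c) {n : ℕ}
    (hST : ∀ ξ < ω ^ τ, ξ ∈ S → ω ^ τ * n + ξ ∈ T) :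
    upperMean (ω ^ τ) (fun ξ => f (ω ^ τ * n + ξ)) = c := by
  refine hS _ c (fun ξ => hf _) fun ξ hξ hdvd hmem => ?_
  simp only [← add_assoc]
  refine hT _ ?_ ?_ (hST ξ hξ hmem)
  · have hlt : ω ^ τ * n + ξ < ω ^ τ * (n + 1 : ℕ) := by
      rw [Nat.cast_add, Nat.cast_one, mul_add_one]
      exact (add_lt_add_iff_left _).2 hξ
    refine hlt.trans_le (le_trans ?_ (opow_le_opow_right omega0_pos (Order.add_one_le_of_lt hτσ)))
    rw [opow_add, opow_one]
    exact mul_le_mul_right (natCast_lt_omega0 _).le _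
  · refine dvd_add (Dvd.dvd.mul_right ?_ _) hdvd
    simpa using opow_dvd_opow ω (Order.one_le_iff_ne_zero.2 hτ)

/-- Up to `max ℵ₀ |σ|` many requirements can be met at length `ω ^ σ` when
every `ω`-block deals with only countably many of them. -/
theorem exists_forcesMean (σ : Ordinal.{0}) : σ ≠ 0 → ∀ I : Type,
    Cardinal.mk I ≤ max Cardinal.aleph0 σ.card →
    ∃ F : Ordinal.{0} → Set I, (∀ ξ, (F ξ).Countable) ∧ ∀ i, ForcesMean σ {ξ | i ∈ F ξ} := by
  induction σ using Ordinal.limitRecOn with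
  | zero => exact fun h => absurd rfl h
  | add_one τ ih =>
    intro _ I hI
    rcases eq_or_ne τ 0 with rfl | hτ
    · have : Countable I := Cardinal.mk_le_aleph0_iff.1 (by simpa using hI)
      refine ⟨fun _ => Set.univ, fun _ => Set.countable_univ, fun i f c hf h => ?_⟩
      simpa using h 0 (opow_pos _ omega0_pos) (dvd_zero _) (Set.mem_univ _)
    · have hI' : Cardinal.mk I ≤ max Cardinal.aleph0 τ.card := by
        refine hI.trans (max_le (le_max_left _ _) ?_)
        rw [card_add, card_one]
        exact Cardinal.add_le_of_le (le_max_left _ _) (le_max_right _ _)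
          (Cardinal.one_le_aleph0.trans (le_max_left _ _))
      obtain ⟨F, hF, hforce⟩ := ih hτ I hI'
      refine ⟨fun ξ => F (ξ % ω ^ τ), fun ξ => hF _, fun i f c hf h => ?_⟩
      refine upperMean_opow_add_one_of_blocks hf fun n _ =>
        (hforce i).upperMean_block hτ (Order.lt_add_one_iff.2 le_rfl) hf h fun ξ hξ hmem => ?_
      simpa [mul_add_mod_self, mod_eq_of_lt hξ] using hmem
  | limit σ hlim ih =>
    intro _ I hI
    have hI' : Cardinal.mk I ≤ σ.card :=
      hI.trans (max_le (aleph0_le_card.2 (omega0_le_of_isSuccLimit hlim)) le_rfl)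
    obtain ⟨e⟩ : Nonempty (I ↪ Set.Iio σ) := by
      rw [← Cardinal.lift_mk_le', Cardinal.mk_Iio_ordinal, Cardinal.lift_uzero, Cardinal.lift_le]
      exact hI'
    have hG (τ : Ordinal.{0}) : ∃ G : Ordinal.{0} → Set {i : I // (e i).1 < τ},
        (∀ ξ, (G ξ).Countable) ∧
          (τ ≠ 0 → τ < σ → ∀ i, ForcesMean τ {ξ | i ∈ G ξ}) := by
      by_cases hτ : τ ≠ 0 ∧ τ < σ
      · have hcard : Cardinal.mk {i : I // (e i).1 < τ} ≤ max Cardinal.aleph0 τ.card := by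
          refine le_max_of_le_right ?_
          have : Nonempty ({i : I // (e i).1 < τ} ↪ Set.Iio τ) :=
            ⟨⟨fun i => ⟨(e i.1).1, i.2⟩, fun i j hij =>
              Subtype.ext (e.injective (Subtype.ext (Subtype.mk.inj hij)))⟩⟩
          rw [← Cardinal.lift_mk_le', Cardinal.mk_Iio_ordinal, Cardinal.lift_uzero,
            Cardinal.lift_le] at this
          exact this
        obtain ⟨G, h₁, h₂⟩ := ih τ hτ.2 hτ.1 _ hcard
        exact ⟨G, h₁, fun _ _ => h₂⟩
      · exact ⟨fun _ => ∅, fun _ => Set.countable_empty, fun h₁ h₂ => absurd ⟨h₁, h₂⟩ hτ⟩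
    choose G hGc hGf using hG
    refine ⟨fun ξ => {i | ∃ τ, τ = log ω ξ ∧ ∃ h : (e i).1 < τ, ⟨i, h⟩ ∈ G τ (ξ % ω ^ τ)},
      fun ξ => ?_, fun i f c hf h => ?_⟩
    · refine ((hGc (log ω ξ) (ξ % ω ^ log ω ξ)).image Subtype.val).mono ?_
      rintro i ⟨_, rfl, hi, hmem⟩
      exact ⟨_, hmem, rfl⟩
    · refine upperMean_opow_of_blocks hf (fun τ hτ hτσ n hn => ?_) σ le_rfl
        (hlim.add_one_lt (e i).2)
      have hτ0 : τ ≠ 0 := (zero_le.trans_lt hτ).ne'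
      refine (hGf τ hτ0 hτσ ⟨i, hτ⟩).upperMean_block hτ0 hτσ hf h fun ξ hξ hmem => ?_
      refine ⟨τ, (stdBlocks_opow_mul_add hn hξ).1.symm, hτ, ?_⟩
      rwa [mul_add_mod_self, mod_eq_of_lt hξ]

theorem aleph0_lt_mk_of_atomless {X : Type} [MeasurableSpace X]
    (m : Measure X) [IsProbabilityMeasure m]
    (hatomless : ∀ Y : Set X, MeasurableSet Y → 0 < m Y →
      ∃ Z ⊆ Y, MeasurableSet Z ∧ 0 < m Z ∧ m Z < m Y) :
    Cardinal.aleph0 < Cardinal.mk X := by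
  by_contra hX
  have : Countable X := Cardinal.mk_le_aleph0_iff.1 (not_lt.1 hX)
  have hnull (x : X) : m (measurableAtom x) = 0 := by
    by_contra hpos
    obtain ⟨Z, hZ, hZm, hZ0, hlt⟩ :=
      hatomless _ (MeasurableSet.measurableAtom_of_countable x) (pos_iff_ne_zero.2 hpos)
    obtain ⟨z, hz⟩ : Z.Nonempty := nonempty_of_measure_ne_zero hZ0.ne'
    have hxZ : x ∈ Z := by
      by_contra hx
      exact mem_of_mem_measurableAtom (hZ hz) hZm.compl hx hz
    exact (measure_mono (measurableAtom_subset hZm hxZ)).not_gt hlt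
  have huniv : m Set.univ = 0 := by
    refine measure_mono_null (fun x _ => ?_) (measure_iUnion_null hnull)
    exact Set.mem_iUnion.2 ⟨x, mem_measurableAtom_self x⟩
  simp at huniv

theorem exists_wellFounded_rec {ι : Type*} [LT ι] [WellFoundedLT ι] {α : Type*}
    (P : (i : ι) → ((j : ι) → j < i → α) → α → Prop) (h : ∀ i prev, ∃ a, P i prev a) :
    ∃ f : ι → α, ∀ i, P i (fun j _ => f j) (f i) := by
  choose g hg using h
  refine ⟨(wellFounded_lt (α := ι)).fix g, fun i => ?_⟩
  conv => arg 3; rw [WellFounded.fix_eq]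
  exact hg i _

/-- The points which lie in the same ones of the sets `A 0, …, A (n - 1)` as `x` does. -/
def initialAtom {X : Type} (A : ℕ → Set X) (n : ℕ) (x : X) : Set X :=
  {z | ∀ k < n, z ∈ A k ↔ x ∈ A k}

theorem measurableSet_initialAtom {X : Type} [MeasurableSpace X] {A : ℕ → Set X}
    (hA : ∀ k, MeasurableSet (A k)) (n : ℕ) (x : X) : MeasurableSet (initialAtom A n x) := by
  have heq : initialAtom A n x = ⋂ k, ⋂ _ : k < n, {z | z ∈ A k ↔ x ∈ A k} := by
    ext z
    simp [initialAtom]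
  rw [heq]
  refine MeasurableSet.iInter fun k => MeasurableSet.iInter fun _ => ?_
  by_cases hx : x ∈ A k
  · simpa [hx] using hA k
  · simp only [hx, iff_false]
    exact (hA k).compl

theorem ae_measure_initialAtom_ne_zero {X : Type} [MeasurableSpace X] (m : Measure X)
    (A : ℕ → Set X) (n : ℕ) : ∀ᵐ x ∂m, m (initialAtom A n x) ≠ 0 := by
  classical
  have h (T : Finset ℕ) : ∀ᵐ x ∂m, x ∈ {z | ∀ k < n, z ∈ A k ↔ k ∈ T} →
      m {z | ∀ k < n, z ∈ A k ↔ k ∈ T} ≠ 0 := by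
    by_cases h0 : m {z | ∀ k < n, z ∈ A k ↔ k ∈ T} = 0
    · filter_upwards [measure_eq_zero_iff_ae_notMem.1 h0] with x hx hx'
      exact absurd hx' hx
    · exact Filter.Eventually.of_forall fun _ _ => h0
  filter_upwards [ae_all_iff.2 h] with x hx
  have heq : initialAtom A n x =
      {z | ∀ k < n, z ∈ A k ↔ k ∈ (Finset.range n).filter fun k => x ∈ A k} := by
    ext z
    refine forall₂_congr fun k hk => ?_
    simp [hk]
  rw [heq]
  refine hx _ fun k hk => ?_
  simp [hk]

open Filter Topology in
theorem exists_seq_tendsto_frequency {X : Type} [MeasurableSpace X] (m : Measure X)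
    [IsProbabilityMeasure m] {A : ℕ → Set X} (hA : ∀ k, MeasurableSet (A k)) :
    ∃ y : ℕ → X, (∀ k, Tendsto (fun n : ℕ =>
        (∑ i ∈ Finset.range n, (A k).indicator (fun _ => (1 : ℝ)) (y i)) / n)
        atTop (𝓝 (m (A k)).toReal)) ∧
      ∀ n, m (initialAtom A n (y n)) ≠ 0 := by
  let P : Measure (ℕ → X) := Measure.infinitePi fun _ => m
  have hmeas (k : ℕ) : Measurable ((A k).indicator fun _ => (1 : ℝ)) :=
    measurable_const.indicator (hA k)
  have hpres (i : ℕ) : MeasurePreserving (Function.eval i) P m :=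
    measurePreserving_eval_infinitePi (fun _ : ℕ => m) i
  have hlaw (k : ℕ) : ∀ᵐ y ∂P, Tendsto (fun n : ℕ =>
      (∑ i ∈ Finset.range n, (A k).indicator (fun _ => (1 : ℝ)) (y i)) / n)
      atTop (𝓝 (m (A k)).toReal) := by
    have hmean : ∫ y, (A k).indicator (fun _ => (1 : ℝ)) (y 0) ∂P = (m (A k)).toReal := by
      have := integral_map (μ := P) (φ := Function.eval 0) (hpres 0).measurable.aemeasurable
        (f := (A k).indicator fun _ => (1 : ℝ)) (hmeas k).aestronglyMeasurable
      rw [(hpres 0).map_eq, integral_indicator_const _ (hA k)] at this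
      simpa [Measure.real] using this.symm
    let Y : ℕ → (ℕ → X) → ℝ := fun i y => (A k).indicator (fun _ => (1 : ℝ)) (y i)
    have hint : Integrable (Y 0) P := by
      have hint : Integrable ((A k).indicator fun _ => (1 : ℝ)) m :=
        (integrable_const 1).indicator (hA k)
      exact (hpres 0).integrable_comp_of_integrable hint
    have hindep : ProbabilityTheory.iIndepFun Y P :=
      ProbabilityTheory.iIndepFun_infinitePi (Ω := fun _ : ℕ => X) (P := fun _ : ℕ => m)
        (X := fun _ => (A k).indicator fun _ => (1 : ℝ)) fun _ => hmeas k
    have hident (i : ℕ) : ProbabilityTheory.IdentDistrib (Y i) (Y 0) P P :=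
      ProbabilityTheory.IdentDistrib.comp (u := (A k).indicator fun _ => (1 : ℝ))
        (f := fun y : ℕ → X => y i) (g := fun y : ℕ → X => y 0)
        ⟨(hpres i).measurable.aemeasurable, (hpres 0).measurable.aemeasurable,
          (hpres i).map_eq.trans (hpres 0).map_eq.symm⟩ (hmeas k)
    have hstrong := ProbabilityTheory.strong_law_ae_real Y hint
      (fun i j hij => hindep.indepFun hij) hident
    rwa [hmean] at hstrong
  have hatom (n : ℕ) : ∀ᵐ y ∂P, m (initialAtom A n (y n)) ≠ 0 :=
    (hpres n).quasiMeasurePreserving.ae (ae_measure_initialAtom_ne_zero m A n)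
  obtain ⟨y, h₁, h₂⟩ := ((ae_all_iff.2 hlaw).and (ae_all_iff.2 hatom)).exists
  exact ⟨y, h₁, h₂⟩

open Filter Topology in
/-- Countably many measurable sets are captured by an injective sequence of length `ω` which starts
at a prescribed point and avoids a given set of cardinality less than that of `X`. -/
theorem exists_injective_seq_tendsto_frequency {X : Type} [MeasurableSpace X] (m : Measure X)
    [IsProbabilityMeasure m] (hX : Cardinal.aleph0 ≤ Cardinal.mk X)
    (hYX : ∀ Y : Set X, MeasurableSet Y → 0 < m Y → Cardinal.mk Y = Cardinal.mk X)
    {A : ℕ → Set X} (hA : ∀ k, MeasurableSet (A k)) {B : Set X}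
    (hB : Cardinal.mk B < Cardinal.mk X) {p : X} (hp : p ∉ B) :
    ∃ y : ℕ → X, Function.Injective y ∧ y 0 = p ∧ (∀ n, y n ∉ B) ∧
      ∀ k, Tendsto (fun n : ℕ =>
        (∑ i ∈ Finset.range n, (A k).indicator (fun _ => (1 : ℝ)) (y i)) / n)
        atTop (𝓝 (m (A k)).toReal) := by
  obtain ⟨z, hz, hatom⟩ := exists_seq_tendsto_frequency m hA
  obtain ⟨y, hy⟩ := exists_wellFounded_rec (ι := ℕ) (α := X)
    (fun n prev a => (n = 0 → a = p) ∧ (n ≠ 0 → a ∈ initialAtom A n (z n)) ∧ a ∉ B ∧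
      ∀ j h, prev j h ≠ a) fun n prev => by
    rcases eq_or_ne n 0 with rfl | hn
    · exact ⟨p, fun _ => rfl, fun h => absurd rfl h, hp, fun j h => absurd h (Nat.not_lt_zero j)⟩
    · let R : Set X := Set.range fun j : Fin n => prev j.1 j.2
      have hcard := hYX _ (measurableSet_initialAtom hA n (z n)) (pos_iff_ne_zero.2 (hatom n))
      have hlt : Cardinal.mk (B ∪ R : Set X) < Cardinal.mk (initialAtom A n (z n)) := by
        rw [hcard]
        exact (Cardinal.mk_union_le _ _).trans_lt (Cardinal.add_lt_of_lt hX hB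
          ((Set.finite_range _).lt_aleph0.trans_le hX))
      obtain ⟨a, ha, hnot⟩ : ∃ a ∈ initialAtom A n (z n), a ∉ B ∪ R := by
        by_contra! h
        exact (Cardinal.mk_le_mk_of_subset h).not_gt hlt
      exact ⟨a, fun h => absurd h hn, fun _ => ha, fun h => hnot (Or.inl h),
        fun j hj h => hnot (Or.inr ⟨⟨j, hj⟩, h⟩)⟩
  refine ⟨y, Function.Injective.of_lt_imp_ne fun i j hij => (hy j).2.2.2 i hij, (hy 0).1 rfl,
    fun n => (hy n).2.2.1, fun k => ?_⟩
  have hdiff : Tendsto (fun i => (A k).indicator (fun _ => (1 : ℝ)) (y i) -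
      (A k).indicator (fun _ => (1 : ℝ)) (z i)) atTop (𝓝 0) := by
    refine tendsto_const_nhds.congr' ?_
    filter_upwards [eventually_gt_atTop k] with i hi
    have hiff := (hy i).2.1 (by omega) k hi
    by_cases hk : z i ∈ A k
    · simp [hk, hiff.2 hk]
    · simp [hk, mt hiff.1 hk]
  have hsum := hdiff.cesaro.add (hz k)
  rw [zero_add] at hsum
  refine hsum.congr fun n => ?_
  rw [Finset.sum_sub_distrib]
  ring

theorem omega0_opow_ord_eq {c : Cardinal.{0}} (hc : Cardinal.aleph0 < c) : ω ^ c.ord = c.ord := by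
  have hω : (ω : Ordinal.{0}) < c.ord := by
    rwa [Cardinal.lt_ord, card_omega0]
  refine le_antisymm ?_ (right_le_opow _ one_lt_omega0)
  rw [opow_le_of_isSuccLimit omega0_ne_zero (Cardinal.isSuccLimit_ord hc.le)]
  exact fun a ha => (isPrincipal_opow_ord hc.le hω ha).le

open Filter Topology in
/-- There is an injective and exhaustive family of `ω`-sequences, indexed by the ordinals below
the initial ordinal of `X`, such that the one with index `ι` captures the countably many sets
in `F ι`. -/
theorem exists_capturing_blocks {X : Type} [MeasurableSpace X]
    (m : Measure X) [IsProbabilityMeasure m] (hX : Cardinal.aleph0 < Cardinal.mk X)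
    (hYX : ∀ Y : Set X, MeasurableSet Y → 0 < m Y → Cardinal.mk Y = Cardinal.mk X)
    (F : Ordinal.{0} → Set {A : Set X // MeasurableSet A}) (hF : ∀ ι, (F ι).Countable) :
    ∃ y : Ordinal.{0} → ℕ → X,
      (∀ ι < (Cardinal.mk X).ord, Function.Injective (y ι)) ∧
      (∀ ι < (Cardinal.mk X).ord, ∀ ι' < ι, ∀ n n', y ι n ≠ y ι' n') ∧
      (∀ p, ∃ ι < (Cardinal.mk X).ord, ∃ n, y ι n = p) ∧
      ∀ ι < (Cardinal.mk X).ord, ∀ A ∈ F ι, Tendsto (fun n : ℕ =>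
        (∑ i ∈ Finset.range n, A.1.indicator (fun _ => (1 : ℝ)) (y ι i)) / n)
        atTop (𝓝 (m A.1).toReal) := by
  obtain ⟨e⟩ : Nonempty (X ≃ Set.Iio (Cardinal.mk X).ord) := by
    rw [← Cardinal.lift_mk_eq', Cardinal.mk_Iio_ordinal, Cardinal.lift_uzero, Cardinal.card_ord]
  have hX0 : Cardinal.mk X ≠ 0 := (Cardinal.aleph0_pos.trans hX).ne'
  have : Nonempty X := Cardinal.mk_ne_zero_iff.1 hX0
  have : Nonempty {A : Set X // MeasurableSet A} := ⟨⟨∅, .empty⟩⟩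
  obtain ⟨y, hy⟩ := exists_wellFounded_rec (ι := Ordinal.{0}) (α := ℕ → X)
    (fun ι prev a => ι < (Cardinal.mk X).ord → Function.Injective a ∧
      (∀ ι' h n n', a n ≠ prev ι' h n') ∧
      (∀ p, (e p).1 = ι → (∃ n, a n = p) ∨ ∃ ι' h n, prev ι' h n = p) ∧
      ∀ A ∈ F ι, Tendsto (fun n : ℕ =>
        (∑ i ∈ Finset.range n, A.1.indicator (fun _ => (1 : ℝ)) (a i)) / n)
        atTop (𝓝 (m A.1).toReal)) fun ι prev => by
    by_cases hι : ι < (Cardinal.mk X).ord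
    swap
    · exact ⟨Classical.arbitrary _, fun h => absurd h hι⟩
    let B : Set X := Set.range fun q : Set.Iio ι × ℕ => prev q.1.1 q.1.2 q.2
    have hB : Cardinal.mk B < Cardinal.mk X := by
      have hle : Cardinal.lift.{1} (Cardinal.mk B) ≤ Cardinal.mk (Set.Iio ι × ℕ) := by
        simpa only [Cardinal.lift_uzero] using Cardinal.mk_range_le_lift
          (f := fun q : Set.Iio ι × ℕ => prev q.1.1 q.1.2 q.2)
      rw [← Cardinal.lift_lt.{0, 1}]
      refine hle.trans_lt ?_
      rw [Cardinal.mk_prod, Cardinal.mk_Iio_ordinal, Cardinal.lift_uzero, Cardinal.mk_nat,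
        ← Cardinal.lift_mul, Cardinal.lift_lt]
      exact Cardinal.mul_lt_of_lt hX.le (Cardinal.lt_ord.1 hι) hX
    obtain ⟨p, hp, hpe⟩ : ∃ p, p ∉ B ∧ ∀ q, (e q).1 = ι → q = p ∨ q ∈ B := by
      by_cases hq : e.symm ⟨ι, hι⟩ ∈ B
      · obtain ⟨p, hp⟩ : ∃ p, p ∉ B := by
          by_contra! h
          rw [Set.eq_univ_of_forall h, Cardinal.mk_univ] at hB
          exact hB.false
        refine ⟨p, hp, fun q hqι => Or.inr ?_⟩
        convert hq
        exact (e.symm_apply_eq.2 (Subtype.ext hqι.symm)).symm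
      · exact ⟨_, hq, fun q hqι => Or.inl (e.symm_apply_eq.2 (Subtype.ext hqι.symm)).symm⟩
    obtain ⟨A, hA⟩ := Set.countable_iff_exists_subset_range.1 (hF ι)
    obtain ⟨a, ha, ha0, haB, hlim⟩ := exists_injective_seq_tendsto_frequency m hX.le hYX
      (A := fun k => (A k).1) (fun k => (A k).2) hB hp
    refine ⟨a, fun _ => ⟨ha, fun ι' h n n' heq => haB n ⟨(⟨ι', h⟩, n'), heq.symm⟩,
      fun q hq => ?_, fun A' hA' => ?_⟩⟩
    · rcases hpe q hq with rfl | ⟨⟨ι', n⟩, h⟩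
      · exact Or.inl ⟨0, ha0⟩
      · exact Or.inr ⟨ι'.1, ι'.2, n, h⟩
    · obtain ⟨k, rfl⟩ := hA hA'
      exact hlim k
  refine ⟨y, fun ι hι => (hy ι hι).1, fun ι hι ι' h n n' => (hy ι hι).2.1 ι' h n n',
    fun p => ?_, fun ι hι => (hy ι hι).2.2.2⟩
  have hι := (e p).2
  rcases (hy _ hι).2.2.1 p rfl with ⟨n, hn⟩ | ⟨ι', h, n, hn⟩
  · exact ⟨_, hι, n, hn⟩
  · exact ⟨ι', h.trans hι, n, hn⟩


/-- Theorem: capturing well-ordering.  Let `(X, Σ, m)` be an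
atomless probability space with `card Σ ≤ card X` and `card Y = card X` for every
measurable `Y` of positive measure.  Then there is a well-ordering of `X` — a map
`x` from the ordinals that is a bijection from the ordinals below the initial
ordinal of `card X` onto `X` — that captures `(X, Σ, m)`. -/
theorem exists_capturing_wellOrdering {X : Type} [MeasurableSpace X]
    (m : Measure X) [IsProbabilityMeasure m]
    (hatomless : ∀ Y : Set X, MeasurableSet Y → 0 < m Y →
      ∃ Z ⊆ Y, MeasurableSet Z ∧ 0 < m Z ∧ m Z < m Y)
    (hSigmaX : Cardinal.mk {A : Set X // MeasurableSet A} ≤ Cardinal.mk X)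
    (hYX : ∀ Y : Set X, MeasurableSet Y → 0 < m Y → Cardinal.mk Y = Cardinal.mk X) :
    ∃ x : Ordinal.{0} → X,
      Set.BijOn x (Set.Iio (Cardinal.mk X).ord) Set.univ ∧
      ∀ A : Set X, MeasurableSet A →
        upperMean (Cardinal.mk X).ord
          (fun ξ => A.indicator (fun _ => (1 : ℝ)) (x ξ)) = (m A).toReal := by
  have hX := aleph0_lt_mk_of_atomless m hatomless
  have hord := omega0_opow_ord_eq hX
  obtain ⟨F, hF, hforce⟩ := exists_forcesMean (Cardinal.mk X).ord
    (Cardinal.ord_pos.2 (Cardinal.aleph0_pos.trans hX)).ne' {A : Set X // MeasurableSet A}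
    (by rw [Cardinal.card_ord]; exact le_max_of_le_right hSigmaX)
  obtain ⟨y, hinj, hdisj, hsurj, hlim⟩ :=
    exists_capturing_blocks m hX hYX (fun ι => F (ω * ι)) fun ι => hF _
  let x : Ordinal.{0} → X := fun ξ => y (ξ / ω) (Cardinal.toNat (ξ % ω).card)
  have hx (ι : Ordinal.{0}) (n : ℕ) : x (ω * ι + n) = y ι n := by
    simp only [x]
    rw [mul_add_div _ omega0_ne_zero, div_eq_zero_of_lt (natCast_lt_omega0 n), add_zero,
      mul_add_mod_self, mod_eq_of_lt (natCast_lt_omega0 n), card_nat, Cardinal.toNat_natCast]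
  have hdecomp (ξ : Ordinal.{0}) (hξ : ξ < (Cardinal.mk X).ord) :
      ∃ ι < (Cardinal.mk X).ord, ∃ n : ℕ, ξ = ω * ι + n := by
    obtain ⟨n, hn⟩ := lt_omega0.1 (mod_lt ξ omega0_ne_zero)
    refine ⟨ξ / ω, (div_le_of_le_mul (le_mul_right _ omega0_pos)).trans_lt hξ, n, ?_⟩
    rw [← hn, div_add_mod]
  refine ⟨x, ⟨fun _ _ => Set.mem_univ _, ?_, fun p _ => ?_⟩, fun A hA => ?_⟩
  · intro ξ hξ ξ' hξ' heq
    obtain ⟨ι, hι, n, rfl⟩ := hdecomp ξ hξ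
    obtain ⟨ι', hι', n', rfl⟩ := hdecomp ξ' hξ'
    rw [hx, hx] at heq
    rcases lt_trichotomy ι ι' with h | rfl | h
    · exact absurd heq.symm (hdisj ι' hι' ι h n' n)
    · rw [hinj ι hι heq]
    · exact absurd heq (hdisj ι hι ι' h n n')
  · obtain ⟨ι, hι, n, rfl⟩ := hsurj p
    have hω : (ω : Ordinal.{0}) < (Cardinal.mk X).ord := by
      rwa [Cardinal.lt_ord, card_omega0]
    exact ⟨ω * ι + n, isPrincipal_add_ord hX.le (isPrincipal_mul_ord hX.le hω hι)
      ((natCast_lt_omega0 n).trans hω), hx ι n⟩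
  · have hbdd (ξ : Ordinal.{0}) : |A.indicator (fun _ => (1 : ℝ)) (x ξ)| ≤ 1 := by
      by_cases h : x ξ ∈ A <;> simp [h]
    have hmean := hforce ⟨A, hA⟩ (fun ξ => A.indicator (fun _ => (1 : ℝ)) (x ξ)) (m A).toReal hbdd
    rw [hord] at hmean
    refine hmean fun ξ hξ hdvd hmem => ?_
    obtain ⟨ι, rfl⟩ := hdvd
    refine upperMean_omega0_of_tendsto (fun n => hbdd _) ?_
    simp only [hx]
    exact hlim ι ((le_mul_right _ omega0_pos).trans_lt hξ) ⟨A, hA⟩ hmem
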